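/- There exists a universal constant c > 0 such that for every integer n ≥ 2 and every integer r with 1 ≤ r ≤ n/2, there exists an anti-Monge matrix θ ∈ ℝ^{n×n} (D θ Dᵀ ≥ 0 entrywise) with V(θ) > 0 such that every matrix θ_r ∈ ℝ^{n×n} of rank at most r satisfies ‖θ_r - θ‖_F² ≥ c (n² / r³) V(θ)². -/

import Mathlib

open Matrix

noncomputable section

/-- The first-order difference matrix `D ∈ ℝ^{(n-1)×n}` (here with `n = m+2`). -/
def diffMat (m : ℕ) : Matrix (Fin (m+1)) (Fin (m+2)) ℝ :=
  Matrix.of fun i j => if j = i.castSucc then -1 else if j = i.succ then 1 else 0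

/-- `V(θ)` for a square matrix. -/
def Vtot {m : ℕ} (θ : Matrix (Fin (m+2)) (Fin (m+2)) ℝ) : ℝ :=
  θ 0 0 + θ (Fin.last (m+1)) (Fin.last (m+1))
    - θ (Fin.last (m+1)) 0 - θ 0 (Fin.last (m+1))

/-- Squared Frobenius norm. -/
def frobSq {a b : ℕ} (M : Matrix (Fin a) (Fin b) ℝ) : ℝ := ∑ i, ∑ j, (M i j) ^ 2

lemma diffMat_mul_apply {m : ℕ} {ι : Type*} (N : Matrix (Fin (m+2)) ι ℝ) (a : Fin (m+1)) (j : ι) :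
    (diffMat m * N) a j = N a.succ j - N a.castSucc j := by
  have h : ∀ k, diffMat m a k * N k j =
      (if k = a.succ then N k j else 0) - (if k = a.castSucc then N k j else 0) := by
    intro k
    by_cases h1 : k = a.castSucc
    · simp [diffMat, h1, a.castSucc_lt_succ.ne]
    · simp [diffMat, h1]
  simp [Matrix.mul_apply, h]

lemma diffMat_mul_mul_transpose_apply {m : ℕ} (N : Matrix (Fin (m+2)) (Fin (m+2)) ℝ)
    (a b : Fin (m+1)) :
    (diffMat m * N * (diffMat m)ᵀ) a b =
      N a.succ b.succ - N a.castSucc b.succ - (N a.succ b.castSucc - N a.castSucc b.castSucc) := by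
  have h : (diffMat m * N * (diffMat m)ᵀ) a b = (diffMat m * (diffMat m * N)ᵀ) b a := by
    rw [← Matrix.transpose_apply (diffMat m * N * (diffMat m)ᵀ), Matrix.transpose_mul,
      Matrix.transpose_transpose]
  simp only [h, diffMat_mul_apply, Matrix.transpose_apply]

/-- The matrix with entries `min (i + 1) (j + 1)`, whose inverse is a discrete Laplacian. -/
def minMat (K : ℕ) : Matrix (Fin K) (Fin K) ℝ :=
  Matrix.of fun i j => ((min (i + 1 : ℕ) (j + 1) : ℕ) : ℝ)

lemma min_second_difference (i j : ℕ) :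
    2 * ((min (i + 1) (j + 1) : ℕ) : ℝ) - (min i (j + 1) : ℕ) - (min (i + 2) (j + 1) : ℕ) =
      if j = i then 1 else 0 := by
  rcases lt_trichotomy i j with h | h | h
  · rw [min_eq_left (by omega), min_eq_left (by omega), min_eq_left (by omega), if_neg h.ne']
    push_cast; ring
  · subst h
    rw [min_self, min_eq_left (by omega), min_eq_right (by omega), if_pos rfl]
    push_cast; ring
  · rw [min_eq_right (by omega), min_eq_right (by omega), min_eq_right (by omega), if_neg h.ne]
    ring

/-- The smallest singular value of `minMat K` is bounded below uniformly in `K`. -/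
lemma sum_sq_le_minMat_mulVec (K : ℕ) (v : Fin K → ℝ) :
    ∑ i, v i ^ 2 ≤ 24 * ∑ i, (minMat K *ᵥ v) i ^ 2 := by
  set w : ℕ → ℝ := fun i => ∑ j : Fin K, ((min i (j + 1 : ℕ) : ℕ) : ℝ) * v j with hw
  have hwM : ∀ i : Fin K, (minMat K *ᵥ v) i = w (i + 1) := fun i => rfl
  have hv : ∀ i : Fin K, v i = 2 * w (i + 1) - w i - w (i + 2) := by
    intro i
    simp only [hw, Finset.mul_sum, ← Finset.sum_sub_distrib]
    have : ∀ j : Fin K, 2 * (((min (i + 1 : ℕ) (j + 1 : ℕ) : ℕ) : ℝ) * v j)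
        - ((min (i : ℕ) (j + 1 : ℕ) : ℕ) : ℝ) * v j - ((min (i + 2 : ℕ) (j + 1 : ℕ) : ℕ) : ℝ) * v j
        = if j = i then v j else 0 := by
      intro j
      have h := min_second_difference i j
      simp only [← Fin.ext_iff] at h
      calc _ = (2 * ((min (i + 1 : ℕ) (j + 1) : ℕ) : ℝ) - (min (i : ℕ) (j + 1) : ℕ)
            - (min (i + 2 : ℕ) (j + 1) : ℕ)) * v j := by ring
        _ = _ := by rw [h]; split_ifs <;> simp
    rw [Finset.sum_congr rfl fun j _ => this j, Finset.sum_ite_eq' Finset.univ i,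
      if_pos (Finset.mem_univ i)]
  have hw0 : w 0 = 0 := Finset.sum_eq_zero fun j _ => by
    rw [Nat.zero_min, Nat.cast_zero, zero_mul]
  have hwK : w (K + 1) = w K := by
    refine Finset.sum_congr rfl fun j _ => ?_
    rw [min_eq_right (by omega), min_eq_right (by omega)]
  simp only [hwM]
  rw [Fin.sum_univ_eq_sum_range (fun i => w (i + 1) ^ 2)]
  have hsum : ∑ i, v i ^ 2 ≤
      ∑ i ∈ Finset.range K, 6 * (w (i + 1) ^ 2 + w i ^ 2 + w (i + 2) ^ 2) := by
    rw [← Fin.sum_univ_eq_sum_range (fun i => 6 * (w (i + 1) ^ 2 + w i ^ 2 + w (i + 2) ^ 2))]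
    refine Finset.sum_le_sum fun i _ => ?_
    rw [hv i]
    nlinarith [sq_nonneg (w (i + 1) + 2 * w i), sq_nonneg (w (i + 1) + 2 * w (i + 2)),
      sq_nonneg (w i - w (i + 2))]
  rw [← Finset.mul_sum, Finset.sum_add_distrib, Finset.sum_add_distrib] at hsum
  have hlow : ∑ i ∈ Finset.range K, w i ^ 2 ≤ ∑ i ∈ Finset.range K, w (i + 1) ^ 2 := by
    have h1 := Finset.sum_range_succ (fun i => w i ^ 2) K
    have h2 := Finset.sum_range_succ' (fun i => w i ^ 2) K
    simp only [hw0] at h2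
    nlinarith [sq_nonneg (w K)]
  have hhigh : ∑ i ∈ Finset.range K, w (i + 2) ^ 2 ≤ 2 * ∑ i ∈ Finset.range K, w (i + 1) ^ 2 := by
    have h1 := Finset.sum_range_succ (fun i => w (i + 1) ^ 2) K
    have h2 := Finset.sum_range_succ' (fun i => w (i + 1) ^ 2) K
    have h3 : w K ^ 2 ≤ ∑ i ∈ Finset.range K, w (i + 1) ^ 2 := by
      rcases K with _ | K
      · simp [hw0]
      · exact Finset.single_le_sum (f := fun i => w (i + 1) ^ 2) (fun i _ => sq_nonneg _)
          (Finset.self_mem_range_succ K)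
    simp only [hwK] at h1
    have h4 : ∑ i ∈ Finset.range K, w (i + 1 + 1) ^ 2 = ∑ i ∈ Finset.range K, w (i + 2) ^ 2 := rfl
    nlinarith [sq_nonneg (w (0 + 1))]
  linarith

/-- A lower bound for the distance from `M` to the matrices of rank at most `r`,
in terms of a lower bound on the smallest singular value of `M`. -/
lemma sub_le_mul_frobSq_sub {K r : ℕ} {C : ℝ} (hC : 0 ≤ C) (M A : Matrix (Fin K) (Fin K) ℝ)
    (hM : ∀ v, ∑ i, v i ^ 2 ≤ C * ∑ i, (M *ᵥ v) i ^ 2) (hA : A.rank ≤ r) :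
    (K : ℝ) - r ≤ C * frobSq (A - M) := by
  set S : Submodule ℝ (EuclideanSpace ℝ (Fin K)) :=
    (LinearMap.ker A.mulVecLin).comap (WithLp.linearEquiv 2 ℝ (Fin K → ℝ)).toLinearMap with hS
  have hdim : K ≤ Module.finrank ℝ S + r := by
    have h1 := LinearMap.finrank_range_add_finrank_ker A.mulVecLin
    have h2 : Module.finrank ℝ S = Module.finrank ℝ (LinearMap.ker A.mulVecLin) := by
      rw [hS]
      exact LinearEquiv.finrank_eq (LinearEquiv.ofSubmodule' _ _)
    rw [Module.finrank_fin_fun] at h1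
    unfold Matrix.rank at hA
    omega
  let u := stdOrthonormalBasis ℝ S
  have hu : Orthonormal ℝ (fun k => (u k : EuclideanSpace ℝ (Fin K))) :=
    u.orthonormal.comp_linearIsometry S.subtypeₗᵢ
  have hker : ∀ k, A *ᵥ (u k : EuclideanSpace ℝ (Fin K)).ofLp = 0 := fun k => (u k).2
  have hbessel : ∑ k, ∑ i, ((A - M) *ᵥ (u k : EuclideanSpace ℝ (Fin K)).ofLp) i ^ 2 ≤
      frobSq (A - M) := by
    rw [Finset.sum_comm]
    refine Finset.sum_le_sum fun i _ => ?_
    have h := hu.sum_inner_products_le (WithLp.toLp 2 ((A - M) i)) (s := Finset.univ)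
    simpa [EuclideanSpace.norm_sq_eq, PiLp.inner_apply, Matrix.mulVec, dotProduct] using h
  have hone : ∀ k, 1 ≤ C * ∑ i, ((A - M) *ᵥ (u k : EuclideanSpace ℝ (Fin K)).ofLp) i ^ 2 := by
    intro k
    have h1 : ∑ i, (u k : EuclideanSpace ℝ (Fin K)) i ^ 2 = 1 := by
      have := EuclideanSpace.norm_sq_eq (u k : EuclideanSpace ℝ (Fin K))
      rw [hu.1 k] at this
      simpa using this.symm
    have h2 := hM (u k : EuclideanSpace ℝ (Fin K)).ofLp
    rw [h1] at h2
    simpa [Matrix.sub_mulVec, hker] using h2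
  calc (K : ℝ) - r ≤ Module.finrank ℝ S := by
        have : (K : ℝ) ≤ Module.finrank ℝ S + r := by exact_mod_cast hdim
        linarith
    _ = ∑ _k : Fin (Module.finrank ℝ S), (1 : ℝ) := by simp
    _ ≤ ∑ k, C * ∑ i, ((A - M) *ᵥ (u k : EuclideanSpace ℝ (Fin K)).ofLp) i ^ 2 :=
        Finset.sum_le_sum fun k _ => hone k
    _ ≤ C * frobSq (A - M) := by
        rw [← Finset.mul_sum]
        exact mul_le_mul_of_nonneg_left hbessel hC

lemma sum_comp_le_of_injective {ι κ : Type*} [Fintype ι] [Fintype κ] {e : ι → κ}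
    (he : Function.Injective e) {f : κ → ℝ} (hf : ∀ k, 0 ≤ f k) : ∑ i, f (e i) ≤ ∑ k, f k :=
  (Finset.sum_map Finset.univ ⟨e, he⟩ f).symm.trans_le
    (Finset.sum_le_univ_sum_of_nonneg hf)

lemma sum_frobSq_submatrix_le {n K : ℕ} {ι : Type*} [Fintype ι] (N : Matrix (Fin n) (Fin n) ℝ)
    {e : Fin K × ι → Fin n} (he : Function.Injective e) :
    ∑ s, ∑ t, frobSq (N.submatrix (fun k => e (k, s)) fun k => e (k, t)) ≤ frobSq N := by
  have hcol : ∀ i, ∑ t, ∑ l, N i (e (l, t)) ^ 2 ≤ ∑ j, N i j ^ 2 := by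
    intro i
    rw [← Fintype.sum_prod_type_right' fun l t => N i (e (l, t)) ^ 2]
    exact sum_comp_le_of_injective he (f := fun j => N i j ^ 2) fun _ => sq_nonneg _
  calc ∑ s, ∑ t, frobSq (N.submatrix (fun k => e (k, s)) fun k => e (k, t))
      = ∑ s, ∑ k, ∑ t, ∑ l, N (e (k, s)) (e (l, t)) ^ 2 :=
        Finset.sum_congr rfl fun s _ => Finset.sum_comm
    _ ≤ ∑ s, ∑ k, ∑ j, N (e (k, s)) j ^ 2 :=
        Finset.sum_le_sum fun s _ => Finset.sum_le_sum fun k _ => hcol _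
    _ = ∑ p : Fin K × ι, ∑ j, N (e p) j ^ 2 :=
        (Fintype.sum_prod_type_right' fun k s => ∑ j, N (e (k, s)) j ^ 2).symm
    _ ≤ frobSq N := sum_comp_le_of_injective he (f := fun i => ∑ j, N i j ^ 2)
        fun _ => Finset.sum_nonneg fun _ _ => sq_nonneg _

/-- The `n × n` matrix obtained from `minMat` by repeating each entry on an `L × L` block. -/
def blockMinMat (n L : ℕ) : Matrix (Fin n) (Fin n) ℝ :=
  Matrix.of fun i j => ((min (i / L + 1 : ℕ) (j / L + 1) : ℕ) : ℝ)

lemma Vtot_blockMinMat (m L : ℕ) : Vtot (blockMinMat (m + 2) L) = ((m + 1) / L : ℕ) := by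
  simp [Vtot, blockMinMat]

lemma blockMinMat_antiMonge (m L : ℕ) (a b : Fin (m+1)) :
    0 ≤ (diffMat m * blockMinMat (m + 2) L * (diffMat m)ᵀ) a b := by
  rw [diffMat_mul_mul_transpose_apply]
  simp only [blockMinMat, Matrix.of_apply, Fin.val_succ, Fin.val_castSucc]
  have ha : (a : ℕ) / L ≤ (a + 1) / L := Nat.div_le_div_right (Nat.le_succ _)
  have hb : (b : ℕ) / L ≤ (b + 1) / L := Nat.div_le_div_right (Nat.le_succ _)
  generalize (a : ℕ) / L = a₀ at *
  generalize ((a : ℕ) + 1) / L = a₁ at *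
  generalize (b : ℕ) / L = b₀ at *
  generalize ((b : ℕ) + 1) / L = b₁ at *
  have h : min (a₀ + 1) (b₁ + 1) + min (a₁ + 1) (b₀ + 1) ≤
      min (a₁ + 1) (b₁ + 1) + min (a₀ + 1) (b₀ + 1) := by omega
  have h' : ((min (a₀ + 1) (b₁ + 1) : ℕ) : ℝ) + (min (a₁ + 1) (b₀ + 1) : ℕ) ≤
      (min (a₁ + 1) (b₁ + 1) : ℕ) + (min (a₀ + 1) (b₀ + 1) : ℕ) := by exact_mod_cast h
  linarith

lemma le_frobSq_sub_blockMinMat {n K L r : ℕ} (hKL : K * L ≤ n) (A : Matrix (Fin n) (Fin n) ℝ)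
    (hA : A.rank ≤ r) :
    (L : ℝ) ^ 2 * ((K : ℝ) - r) ≤ 24 * frobSq (A - blockMinMat n L) := by
  let e : Fin K × Fin L → Fin n := fun p => Fin.castLE hKL (finProdFinEquiv p)
  have he : Function.Injective e :=
    (Fin.castLE_injective hKL).comp finProdFinEquiv.injective
  have hdiv : ∀ k s, (e (k, s) : ℕ) / L = k := by
    intro k s
    have hL : 0 < L := s.pos
    simp [e, finProdFinEquiv, Nat.add_mul_div_left _ _ hL, Nat.div_eq_of_lt s.2]
  have hblock : ∀ s t, (K : ℝ) - r ≤
      24 * frobSq ((A - blockMinMat n L).submatrix (fun k => e (k, s)) fun k => e (k, t)) := by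
    intro s t
    have hsub : (blockMinMat n L).submatrix (fun k => e (k, s)) (fun k => e (k, t)) =
        minMat K := by
      ext k l
      simp [blockMinMat, minMat, hdiv]
    rw [Matrix.submatrix_sub, Pi.sub_apply, Pi.sub_apply, hsub]
    exact sub_le_mul_frobSq_sub (by norm_num) _ _ (sum_sq_le_minMat_mulVec K)
      ((Matrix.rank_submatrix_le A _ _).trans hA)
  calc (L : ℝ) ^ 2 * ((K : ℝ) - r) = ∑ _s : Fin L, ∑ _t : Fin L, ((K : ℝ) - r) := by
        simp; ring
    _ ≤ ∑ s, ∑ t, 24 * frobSq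
          ((A - blockMinMat n L).submatrix (fun k => e (k, s)) fun k => e (k, t)) :=
        Finset.sum_le_sum fun s _ => Finset.sum_le_sum fun t _ => hblock s t
    _ ≤ 24 * frobSq (A - blockMinMat n L) := by
        simp only [← Finset.mul_sum]
        exact mul_le_mul_of_nonneg_left (sum_frobSq_submatrix_le _ he) (by norm_num)

/-- Lemma B.1 (tightness of the low-rank approximation rate): there is a universal
`c > 0` so that for every `n ≥ 2` (here `n = m+2`) and every `1 ≤ r ≤ n/2` there is an
anti-Monge `θ ∈ ℝ^{n×n}` with `V(θ) > 0` such that every matrix of rank at most `r` is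
at squared Frobenius distance at least `c n² V(θ)² / r³` from `θ`. -/
theorem low_rank_approx_lower :
    ∃ c : ℝ, 0 < c ∧
      ∀ (m r : ℕ), 1 ≤ r → 2 * r ≤ m + 2 →
        ∃ θ : Matrix (Fin (m+2)) (Fin (m+2)) ℝ,
          (∀ (a b : Fin (m+1)), 0 ≤ (diffMat m * θ * (diffMat m)ᵀ) a b) ∧
          0 < Vtot θ ∧
          ∀ θr : Matrix (Fin (m+2)) (Fin (m+2)) ℝ, θr.rank ≤ r →
            c * (((m:ℝ) + 2) ^ 2 / (r:ℝ) ^ 3) * (Vtot θ) ^ 2 ≤ frobSq (θr - θ) := by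
  refine ⟨1 / 6144, by norm_num, fun m r hr hrm => ?_⟩
  set L := (m + 2) / (2 * r)
  have hL1 : 1 ≤ L := (Nat.one_le_div_iff (by omega)).2 hrm
  have hKL : 2 * r * L ≤ m + 2 := Nat.mul_div_le _ _
  have hlt : m + 2 < 2 * r * L + 2 * r := Nat.lt_mul_div_succ _ (by omega)
  have hle : m + 2 ≤ 4 * r * L := by nlinarith
  refine ⟨blockMinMat (m + 2) L, blockMinMat_antiMonge m L, ?_, fun A hA => ?_⟩
  · rw [Vtot_blockMinMat]
    exact_mod_cast Nat.div_pos (by nlinarith) hL1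
  have hV : Vtot (blockMinMat (m + 2) L) ≤ 4 * r := by
    rw [Vtot_blockMinMat]
    have : (m + 1) / L ≤ 4 * r := Nat.div_le_of_le_mul (by nlinarith)
    exact_mod_cast this
  have hV0 : 0 ≤ Vtot (blockMinMat (m + 2) L) := by
    rw [Vtot_blockMinMat]
    positivity
  have hfrob := le_frobSq_sub_blockMinMat hKL A hA
  have hr0 : (0 : ℝ) < r := by exact_mod_cast hr
  have hn : (m : ℝ) + 2 ≤ 4 * r * L := by exact_mod_cast hle
  calc 1 / 6144 * (((m : ℝ) + 2) ^ 2 / (r : ℝ) ^ 3) * Vtot (blockMinMat (m + 2) L) ^ 2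
      ≤ 1 / 6144 * ((4 * r * L) ^ 2 / (r : ℝ) ^ 3) * (4 * r) ^ 2 := by gcongr
    _ = (L : ℝ) ^ 2 * (((2 * r : ℕ) : ℝ) - r) / 24 := by
        push_cast
        field_simp
        ring
    _ ≤ frobSq (A - blockMinMat (m + 2) L) := by linarith
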